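/- C_m ⊆ V_m, where V_m = ∩_{P ∈ X_m} C(P), i.e., every c with Kdim(R/cR) < m is regular modulo every prime P with Kdim(R/P) = m. -/

import Mathlib

set_option linter.unusedVariables false

/-- `devLE k A` : the deviation (in the Gabriel–Rentschler sense) of the
poset `A` is `≤ k` (for `k : ℕ`).  `devLE 0 A` says every descending chain
eventually stabilizes (DCC), and `devLE (k+1) A` says that in any descending
chain all but finitely many of the factor intervals have deviation `≤ k`. -/
def devLE : ℕ → (A : Type*) → [inst : Preorder A] → Prop
  | 0, A, _ => ∀ f : ℕ → A, Antitone f → ∃ N, ∀ i, N ≤ i → f (i + 1) = f i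
  | (k+1), A, _ => ∀ f : ℕ → A, Antitone f →
      ∃ N, ∀ i, N ≤ i → devLE k (Set.Icc (f (i + 1)) (f i))

/-- The Gabriel–Rentschler Krull dimension of the right `R`-module `M`
(a module over `Rᵐᵒᵖ`) is `≤ k` : the deviation of its submodule lattice is `≤ k`. -/
def kdimLE (R M : Type*) [Ring R] [AddCommGroup M] [Module Rᵐᵒᵖ M] (k : ℕ) : Prop :=
  devLE k (Submodule Rᵐᵒᵖ M)

/-- `c` is a regular element of `R` (neither a left nor a right zero divisor). -/
def regElem (R : Type*) [Ring R] (c : R) : Prop :=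
  (∀ x : R, c * x = 0 → x = 0) ∧ (∀ x : R, x * c = 0 → x = 0)

/-- `C_m = {c ∈ R | Kdim(R/cR) < m}` (for `0 < m`, `Kdim < m` is `Kdim ≤ m-1`). -/
def rCm (R : Type*) [Ring R] (m : ℕ) : Set R :=
  {c | kdimLE R (R ⧸ Submodule.span Rᵐᵒᵖ ({c} : Set R)) (m - 1)}

/-- The m-Gabriel filter `g = {right ideals I | Kdim(R/I) < m}`. -/
def gFilt (R : Type*) [Ring R] (m : ℕ) : Set (Submodule Rᵐᵒᵖ R) :=
  {I | kdimLE R (R ⧸ I) (m - 1)}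

/-- A right ideal `P` is a (two-sided) prime ideal of `R`. -/
def isTwoSidedPrime (R : Type*) [Ring R] (P : Submodule Rᵐᵒᵖ R) : Prop :=
  (∀ a ∈ P, ∀ r : R, r * a ∈ P) ∧ P ≠ ⊤ ∧
    ∀ a b : R, (∀ r : R, a * r * b ∈ P) → a ∈ P ∨ b ∈ P

/-- `c ∈ C(P)` : `c` is regular modulo `P`. -/
def regModP (R : Type*) [Ring R] (P : Submodule Rᵐᵒᵖ R) (c : R) : Prop :=
  ∀ x : R, (c * x ∈ P → x ∈ P) ∧ (x * c ∈ P → x ∈ P)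

/-- `X_m` : the set of (two-sided) prime ideals `P` with `Kdim(R/P) = m`. -/
def xSet (R : Type*) [Ring R] (m : ℕ) : Set (Submodule Rᵐᵒᵖ R) :=
  {P | isTwoSidedPrime R P ∧ kdimLE R (R ⧸ P) m ∧ ¬ kdimLE R (R ⧸ P) (m - 1)}

/-- `V_m = ⋂_{P ∈ X_m} C(P)`. -/
def vSet (R : Type*) [Ring R] (m : ℕ) : Set R :=
  {v | ∀ P ∈ xSet R m, regModP R P v}

/-- Left multiplication by `a` as a right-module (`Rᵐᵒᵖ`-module) endomorphism of `R`. -/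
def lmulHom (R : Type*) [Ring R] (a : R) : R →ₗ[Rᵐᵒᵖ] R where
  toFun x := a * x
  map_add' x y := mul_add a x y
  map_smul' r x := by
    simp [MulOpposite.smul_eq_mul_unop, mul_assoc]

/-- `Q` is a classical right quotient ring of `R` via `f : R →+* Q` :
`f` is injective, regular elements of `R` become units in `Q`, and every
element of `Q` is a right fraction `f a * (f s)⁻¹`. -/
def isRightQuotientRing (R Q : Type*) [Ring R] [Ring Q] (f : R →+* Q) : Prop :=
  Function.Injective f ∧ (∀ s : R, regElem R s → IsUnit (f s)) ∧
    ∀ q : Q, ∃ a s : R, regElem R s ∧ q * f s = f a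

/-- `R^e = {q ∈ Q | qJ ⊆ R for some J in the m-Gabriel filter}`, as a subset of `Q`. -/
def reSet (R Q : Type*) [Ring R] [Ring Q] (f : R →+* Q) (m : ℕ) : Set Q :=
  {q | ∃ J ∈ gFilt R m, ∀ j ∈ J, ∃ r : R, q * f j = f r}

/-- The extension `A·R^e` of a set `A ⊆ R` : the additive subgroup of `Q`
generated by products `f a * q` with `a ∈ A`, `q ∈ R^e` (a right ideal of `R^e`). -/
def extSet (R Q : Type*) [Ring R] [Ring Q] (f : R →+* Q) (m : ℕ) (A : Set R) : Set Q :=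
  (AddSubgroup.closure {x : Q | ∃ a ∈ A, ∃ q ∈ reSet R Q f m, x = f a * q} : Set Q)

/-- The right `R`-module structure on `Q` induced by `f : R →+* Q`. -/
def qMod (R Q : Type*) [Ring R] [Ring Q] (f : R →+* Q) : Module Rᵐᵒᵖ Q :=
  Module.compHom Q (RingHom.op f)

theorem devLE_of_strictMono (k : ℕ) {A B : Type*} [PartialOrder A] [Preorder B]
    (g : A → B) (hg : StrictMono g) (h : devLE k B) : devLE k A := by
  induction k generalizing A B with
  | zero =>
    intro f hf
    obtain ⟨N, hN⟩ := h (g ∘ f) (hg.monotone.comp_antitone hf)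
    refine ⟨N, fun i hi => ?_⟩
    by_contra hne
    have hlt := hg (lt_of_le_of_ne (hf (Nat.le_succ i)) hne)
    exact hlt.ne (hN i hi)
  | succ k ih =>
    intro f hf
    obtain ⟨N, hN⟩ := h (g ∘ f) (hg.monotone.comp_antitone hf)
    refine ⟨N, fun i hi => ?_⟩
    exact ih (fun x : Set.Icc (f (i + 1)) (f i) =>
        (⟨g x.1, hg.monotone x.2.1, hg.monotone x.2.2⟩ :
          Set.Icc ((g ∘ f) (i + 1)) ((g ∘ f) i)))
      (fun _ _ hxy => hg hxy) (hN i hi)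

theorem devLE_prod (k : ℕ) {A B : Type*} [PartialOrder A] [PartialOrder B]
    (hA : devLE k A) (hB : devLE k B) : devLE k (A × B) := by
  induction k generalizing A B with
  | zero =>
    intro f hf
    obtain ⟨N, hN⟩ := hA (fun i => (f i).1) (fun _ _ h => (hf h).1)
    obtain ⟨M, hM⟩ := hB (fun i => (f i).2) (fun _ _ h => (hf h).2)
    exact ⟨max N M, fun i hi => Prod.ext (hN i (le_trans (le_max_left _ _) hi))
      (hM i (le_trans (le_max_right _ _) hi))⟩
  | succ k ih =>
    intro f hf
    obtain ⟨N, hN⟩ := hA (fun i => (f i).1) (fun _ _ h => (hf h).1)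
    obtain ⟨M, hM⟩ := hB (fun i => (f i).2) (fun _ _ h => (hf h).2)
    refine ⟨max N M, fun i hi => ?_⟩
    refine devLE_of_strictMono k
      (fun x : Set.Icc (f (i + 1)) (f i) =>
        ((⟨x.1.1, x.2.1.1, x.2.2.1⟩, ⟨x.1.2, x.2.1.2, x.2.2.2⟩) :
          Set.Icc (f (i + 1)).1 (f i).1 × Set.Icc (f (i + 1)).2 (f i).2))
      (fun _ _ hxy => hxy)
      (ih (hN i (le_trans (le_max_left _ _) hi)) (hM i (le_trans (le_max_right _ _) hi)))

section KrullDimension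

variable {R : Type*} [Ring R] {L M N : Type*} [AddCommGroup L] [Module Rᵐᵒᵖ L]
  [AddCommGroup M] [Module Rᵐᵒᵖ M] [AddCommGroup N] [Module Rᵐᵒᵖ N] {k : ℕ}

theorem kdimLE_of_injective (f : M →ₗ[Rᵐᵒᵖ] N) (hf : Function.Injective f)
    (h : kdimLE R N k) : kdimLE R M k :=
  devLE_of_strictMono k (Submodule.map f) (Submodule.map_strictMono_of_injective hf) h

theorem kdimLE_of_surjective (f : M →ₗ[Rᵐᵒᵖ] N) (hf : Function.Surjective f)
    (h : kdimLE R M k) : kdimLE R N k :=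
  devLE_of_strictMono k (Submodule.comap f) (Submodule.comap_strictMono_of_surjective hf) h

theorem kdimLE_of_ker (g : M →ₗ[Rᵐᵒᵖ] N) (hker : kdimLE R (LinearMap.ker g) k)
    (hN : kdimLE R N k) : kdimLE R M k := by
  refine devLE_of_strictMono k
    (fun X : Submodule Rᵐᵒᵖ M => (X.comap (LinearMap.ker g).subtype, X.map g))
    (fun X Y hXY => lt_of_le_of_ne
      ⟨Submodule.comap_mono hXY.le, Submodule.map_mono hXY.le⟩ fun h => hXY.not_ge ?_)
    (devLE_prod k hker hN)
  obtain ⟨h1, h2⟩ := Prod.mk.inj h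
  intro y hy
  have hgy : g y ∈ X.map g := h2 ▸ Submodule.mem_map_of_mem hy
  obtain ⟨x, hx, hxy⟩ := hgy
  have hker' : y - x ∈ LinearMap.ker g := by simp [LinearMap.mem_ker, hxy]
  have hmem : (⟨y - x, hker'⟩ : LinearMap.ker g) ∈ X.comap (LinearMap.ker g).subtype :=
    h1 ▸ Y.sub_mem hy (hXY.le hx)
  simpa using X.add_mem hmem hx

/-- The middle term of an exact sequence has Krull dimension bounded by the outer terms. -/
theorem kdimLE_of_exact (f : L →ₗ[Rᵐᵒᵖ] M) (g : M →ₗ[Rᵐᵒᵖ] N)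
    (hfg : LinearMap.ker g ≤ LinearMap.range f)
    (hL : kdimLE R L k) (hN : kdimLE R N k) : kdimLE R M k :=
  kdimLE_of_ker g (kdimLE_of_injective (Submodule.inclusion hfg)
    (Submodule.inclusion_injective hfg)
    (kdimLE_of_surjective f.rangeRestrict f.surjective_rangeRestrict hL)) hN

theorem kdimLE_quotient_of_ker_le (f : M →ₗ[Rᵐᵒᵖ] N) (p : Submodule Rᵐᵒᵖ M)
    (hp : LinearMap.ker f ≤ p) (h : kdimLE R N k) : kdimLE R (M ⧸ p) k :=
  kdimLE_of_surjective (Submodule.factor hp) (Submodule.factor_surjective hp)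
    (kdimLE_of_injective ((LinearMap.ker f).liftQ f le_rfl)
      (LinearMap.ker_eq_bot.1 (Submodule.ker_liftQ_eq_bot _ _ _ le_rfl)) h)

theorem kdimLE_quotient_mono {p q : Submodule Rᵐᵒᵖ M} (hpq : p ≤ q)
    (h : kdimLE R (M ⧸ p) k) : kdimLE R (M ⧸ q) k :=
  kdimLE_of_surjective (Submodule.factor hpq) (Submodule.factor_surjective hpq) h

theorem kdimLE_quotient_inf {p q : Submodule Rᵐᵒᵖ M} (hp : kdimLE R (M ⧸ p) k)
    (hq : kdimLE R (M ⧸ q) k) : kdimLE R (M ⧸ (p ⊓ q)) k := by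
  refine kdimLE_quotient_of_ker_le (p.mkQ.prod q.mkQ) _ (by simp) ?_
  exact kdimLE_of_exact (LinearMap.inr _ _ _) (LinearMap.fst _ _ _)
    (LinearMap.range_inr _ _ _).ge hq hp

theorem kdimLE_of_subsingleton [Subsingleton M] : kdimLE R M k := by
  suffices h : ∀ (k : ℕ) (A : Type _) [PartialOrder A] [Subsingleton A], devLE k A from
    h k (Submodule Rᵐᵒᵖ M)
  intro k
  induction k with
  | zero => exact fun A _ _ f _ => ⟨0, fun i _ => Subsingleton.elim _ _⟩
  | succ k ih => exact fun A _ _ f _ => ⟨0, fun i _ => ih _⟩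

end KrullDimension

section RightIdeals

variable {R : Type*} [Ring R] {k : ℕ}

theorem mul_mem_rightIdeal (A : Submodule Rᵐᵒᵖ R) {a : R} (ha : a ∈ A) (r : R) : a * r ∈ A :=
  A.smul_mem (MulOpposite.op r) ha

theorem mem_span_singleton_op {b x : R} :
    x ∈ Submodule.span Rᵐᵒᵖ ({b} : Set R) ↔ ∃ s, b * s = x := by
  rw [Submodule.mem_span_singleton]
  exact ⟨fun ⟨a, ha⟩ => ⟨a.unop, ha⟩, fun ⟨s, hs⟩ => ⟨MulOpposite.op s, hs⟩⟩

/-- `{x | b * x ∈ P}`, the right annihilator of `b` modulo `P`. -/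
def annMod (P : Submodule Rᵐᵒᵖ R) (b : R) : Submodule Rᵐᵒᵖ R := P.comap (lmulHom R b)

theorem mem_annMod {P : Submodule Rᵐᵒᵖ R} {b x : R} : x ∈ annMod P b ↔ b * x ∈ P := Iff.rfl

theorem kdimLE_quotient_annMod_mul {P : Submodule Rᵐᵒᵖ R} {b : R}
    (h : kdimLE R (R ⧸ annMod P b) k) (s : R) : kdimLE R (R ⧸ annMod P (b * s)) k := by
  refine kdimLE_quotient_of_ker_le ((annMod P b).mkQ ∘ₗ lmulHom R s) _ (fun x hx => ?_) h
  have hx' : s * x ∈ annMod P b := by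
    simpa [LinearMap.mem_ker, lmulHom] using hx
  simpa [mem_annMod, mul_assoc] using hx'

/-- In a prime right noetherian ring, a single nonzero right ideal of Krull dimension `≤ k`
forces the whole ring to have Krull dimension `≤ k`; stated here modulo a prime `P`. -/
theorem kdimLE_quotient_of_annMod [IsNoetherian Rᵐᵒᵖ R] {P : Submodule Rᵐᵒᵖ R}
    (hP : isTwoSidedPrime R P) {i : R} (hi : i ∉ P) (hk : kdimLE R (R ⧸ annMod P i) k) :
    kdimLE R (R ⧸ P) k := by
  obtain ⟨hl, -, hpr⟩ := hP
  have hmul : ∀ a b : R, a ∉ P → b ∉ P → ∃ r, a * r * b ∉ P := by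
    intro a b ha hb
    by_contra! h
    exact (hpr a b h).elim ha hb
  obtain ⟨C, ⟨A, hAC, hA⟩, hCmax⟩ := (wellFounded_gt (α := Submodule Rᵐᵒᵖ R)).has_min
    {C | ∃ A : Submodule Rᵐᵒᵖ R, A ⊓ C ≤ P ∧ kdimLE R (R ⧸ A) k}
    ⟨⊥, ⊤, by simp, kdimLE_of_subsingleton⟩
  by_cases hAP : A ≤ P
  · exact kdimLE_quotient_mono hAP hA
  exfalso
  obtain ⟨a, haA, haP⟩ := Set.not_subset.1 hAP
  obtain ⟨r, hr⟩ := hmul a i haP hi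
  obtain ⟨-, ⟨b, ⟨hbA, hbP, hbk⟩, rfl⟩, hbmax⟩ :=
    (wellFounded_gt (α := Submodule Rᵐᵒᵖ R)).has_min
    (annMod P '' {b | b ∈ A ∧ b ∉ P ∧ kdimLE R (R ⧸ annMod P b) k})
    ⟨_, a * r * i, ⟨by rw [mul_assoc]; exact mul_mem_rightIdeal A haA _, hr,
      kdimLE_quotient_mono (fun x hx => by
        rw [mem_annMod, mul_assoc]; exact hl _ hx _) hk⟩, rfl⟩
  obtain ⟨s, hs⟩ := hmul b b hbP hbP
  have hsb : annMod P (b * s * b) ≤ annMod P b := by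
    have hle : annMod P b ≤ annMod P (b * s * b) := fun x hx => by
      rw [mem_annMod, mul_assoc]; exact hl _ hx _
    have hnot := hbmax (annMod P (b * s * b)) ⟨_, ⟨by
      rw [mul_assoc]; exact mul_mem_rightIdeal A hbA _, hs, by
      rw [mul_assoc]; exact kdimLE_quotient_annMod_mul hbk _⟩, rfl⟩
    exact (eq_of_le_of_not_lt hle hnot).ge
  refine hCmax (C ⊔ Submodule.span Rᵐᵒᵖ {b}) ⟨A ⊓ annMod P (b * s), ?_,
    kdimLE_quotient_inf hA (kdimLE_quotient_annMod_mul hbk s)⟩ ?_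
  · rintro x ⟨⟨hxA, hxt⟩, hxC⟩
    obtain ⟨c, hc, y, hy, rfl⟩ := Submodule.mem_sup.1 hxC
    obtain ⟨z, rfl⟩ := mem_span_singleton_op.1 hy
    have hcA : c ∈ A := (Submodule.add_mem_iff_left A (mul_mem_rightIdeal A hbA z)).1 hxA
    have hcP : c ∈ P := hAC ⟨hcA, hc⟩
    refine P.add_mem hcP (hsb ?_)
    have hxt' : b * s * (c + b * z) ∈ P := hxt
    rw [mul_add] at hxt'
    rw [mem_annMod, mul_assoc (b * s)]
    exact (Submodule.add_mem_iff_right P (hl _ hcP _)).1 hxt'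
  · refine lt_of_le_of_ne le_sup_left fun h => hbP (hAC ⟨hbA, ?_⟩)
    rw [h]
    exact Submodule.mem_sup_right (Submodule.mem_span_singleton_self b)

theorem kdimLE_quotient_span_pow {c : R}
    (h : kdimLE R (R ⧸ Submodule.span Rᵐᵒᵖ ({c} : Set R)) k) (n : ℕ) :
    kdimLE R (R ⧸ Submodule.span Rᵐᵒᵖ ({c ^ n} : Set R)) k := by
  induction n with
  | zero =>
    refine kdimLE_quotient_mono (fun x _ => ?_) h
    exact mem_span_singleton_op.2 ⟨x, by simp⟩
  | succ n ih =>
    have hle : Submodule.span Rᵐᵒᵖ ({c ^ (n + 1)} : Set R) ≤ Submodule.span Rᵐᵒᵖ {c} := by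
      rw [Submodule.span_singleton_le_iff_mem]
      exact mem_span_singleton_op.2 ⟨c ^ n, (pow_succ' c n).symm⟩
    have hle' : Submodule.span Rᵐᵒᵖ ({c ^ n} : Set R) ≤
        (Submodule.span Rᵐᵒᵖ ({c ^ (n + 1)} : Set R)).comap (lmulHom R c) := by
      rw [Submodule.span_singleton_le_iff_mem]
      exact mem_span_singleton_op.2 ⟨1, by simp [lmulHom, pow_succ']⟩
    refine kdimLE_of_exact (Submodule.mapQ _ _ (lmulHom R c) hle') (Submodule.factor hle) ?_ ih h
    intro x hx
    obtain ⟨x, rfl⟩ := Submodule.mkQ_surjective _ x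
    have hx' : x ∈ Submodule.span Rᵐᵒᵖ ({c} : Set R) := by
      simpa [LinearMap.mem_ker] using hx
    obtain ⟨y, rfl⟩ := mem_span_singleton_op.1 hx'
    exact ⟨Submodule.Quotient.mk y, rfl⟩

/-- An element `c` with `Kdim (R/cR) ≤ k` is regular modulo every prime `P` for which
`Kdim (R/P) ≤ k` fails. -/
theorem regModP_of_kdimLE_quotient_span [IsNoetherian Rᵐᵒᵖ R] {P : Submodule Rᵐᵒᵖ R}
    (hP : isTwoSidedPrime R P) (hPk : ¬ kdimLE R (R ⧸ P) k) {c : R}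
    (hc : kdimLE R (R ⧸ Submodule.span Rᵐᵒᵖ ({c} : Set R)) k) : regModP R P c := by
  have hl := hP.1
  have small : ∀ x, kdimLE R (R ⧸ annMod P x) k → x ∈ P := fun x hx => by
    by_contra hxP
    exact hPk (kdimLE_quotient_of_annMod hP hxP hx)
  refine fun x => ⟨fun hx => small x ?_, fun hx => small x (kdimLE_quotient_mono ?_ hc)⟩
  · obtain ⟨n, hn⟩ := monotone_stabilizes_iff_noetherian.2 ‹IsNoetherian Rᵐᵒᵖ R›
      ⟨fun n => annMod P (c ^ n), monotone_nat_of_le_succ fun n y hy => by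
        rw [mem_annMod, pow_succ', mul_assoc]; exact hl _ hy _⟩
    have hn' : annMod P (c ^ (n + 1) * c ^ (n + 1)) = annMod P (c ^ (n + 1)) := by
      rw [← pow_add]
      exact (hn (n + 1 + (n + 1)) (by omega)).symm.trans (hn (n + 1) (by omega))
    refine kdimLE_quotient_of_ker_le
      ((Submodule.span Rᵐᵒᵖ ({c ^ (n + 1)} : Set R)).mkQ ∘ₗ lmulHom R x) _ (fun y hy => ?_)
      (kdimLE_quotient_span_pow hc (n + 1))
    have hy' : x * y ∈ Submodule.span Rᵐᵒᵖ ({c ^ (n + 1)} : Set R) := by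
      simpa [LinearMap.mem_ker, lmulHom] using hy
    obtain ⟨z, hz⟩ := mem_span_singleton_op.1 hy'
    rw [mem_annMod, ← hz, ← mem_annMod, ← hn', mem_annMod, mul_assoc, hz, pow_succ]
    have : c ^ n * c * (x * y) = c ^ n * (c * x * y) := by simp only [mul_assoc]
    rw [this]
    exact hl _ (mul_mem_rightIdeal P hx y) _
  · rw [Submodule.span_singleton_le_iff_mem]
    exact hx

end RightIdeals

theorem stmt4 (R : Type) [Ring R] [Nontrivial R] [IsNoetherian Rᵐᵒᵖ R]
    (hprime : ∀ a b : R, (∀ r : R, a * r * b = 0) → a = 0 ∨ b = 0)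
    (n m : ℕ) (hm : 0 < m) (hmn : m < n)
    (hdim : kdimLE R R n ∧ ¬ kdimLE R R (n - 1)) :
    rCm R m ⊆ vSet R m := by
  intro c hc P hP
  exact regModP_of_kdimLE_quotient_span hP.1 hP.2.2 hc
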